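/- arXiv:1901.01803 — 4 statements merged into one kernel-verified Lean document; each statement's English description precedes it below -/
import Mathlib

section
/- Suppose Assumption A holds and Λ ≥ 0 is a constant such that sup_{x ∈ S} |p(x)| ≤ Λ · max_{x ∈ I} |p(x)| for every p ∈ P. Then for every function g : S → ℝ, the unique discrete least-squares reconstruction R g satisfies the stability estimate sup_{x ∈ S} |(R g)(x)| ≤ Λ · √(#I) · max_{x ∈ I} |g(x)|, where #I denotes the number of sampling points. -/
/-- The residual of a least-squares minimizer over a subspace is orthogonal to the minimizer. -/
theorem sum_residual_mul_eq_zero {S : Type*} {P : Submodule ℝ (S → ℝ)} {I : Finset S}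
    {g r : S → ℝ} (hr : r ∈ P)
    (hmin : ∀ p ∈ P, ∑ x ∈ I, (g x - r x) ^ 2 ≤ ∑ x ∈ I, (g x - p x) ^ 2) :
    ∑ x ∈ I, (g x - r x) * r x = 0 := by
  have hquad : ∀ t : ℝ, 0 ≤ (∑ x ∈ I, r x ^ 2) * (t * t)
      + (-2 * ∑ x ∈ I, (g x - r x) * r x) * t + 0 := by
    intro t
    have h := hmin ((1 + t) • r) (P.smul_mem _ hr)
    have hexp : ∑ x ∈ I, (g x - ((1 + t) • r) x) ^ 2 = ∑ x ∈ I, (g x - r x) ^ 2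
        + ((∑ x ∈ I, r x ^ 2) * (t * t) + (-2 * ∑ x ∈ I, (g x - r x) * r x) * t) := by
      simp only [Finset.mul_sum, Finset.sum_mul, ← Finset.sum_add_distrib]
      refine Finset.sum_congr rfl fun x _ => ?_
      simp only [Pi.smul_apply, smul_eq_mul]
      ring
    linarith
  have hdisc := discrim_le_zero hquad
  rw [discrim] at hdisc
  exact pow_eq_zero_iff two_ne_zero |>.mp (le_antisymm (by linarith) (sq_nonneg _))

/-- Least-squares approximation does not increase the discrete `ℓ²` norm. -/
theorem sum_sq_le_of_leastSquares {S : Type*} {P : Submodule ℝ (S → ℝ)} {I : Finset S}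
    {g r : S → ℝ} (hr : r ∈ P)
    (hmin : ∀ p ∈ P, ∑ x ∈ I, (g x - r x) ^ 2 ≤ ∑ x ∈ I, (g x - p x) ^ 2) :
    ∑ x ∈ I, r x ^ 2 ≤ ∑ x ∈ I, g x ^ 2 := by
  have hpyth : ∑ x ∈ I, g x ^ 2 = ∑ x ∈ I, (g x - r x) ^ 2
      + 2 * ∑ x ∈ I, (g x - r x) * r x + ∑ x ∈ I, r x ^ 2 := by
    simp only [Finset.mul_sum, ← Finset.sum_add_distrib]
    exact Finset.sum_congr rfl fun x _ => by ring
  have hres : 0 ≤ ∑ x ∈ I, (g x - r x) ^ 2 := Finset.sum_nonneg fun x _ => sq_nonneg _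
  rw [sum_residual_mul_eq_zero hr hmin] at hpyth
  linarith

/-- Under Assumption A, if `Λ ≥ 0` satisfies
`sup_{x ∈ S} |p x| ≤ Λ · max_{x ∈ I} |p x|` for all `p ∈ P`, then the unique
discrete least-squares reconstruction `r = R g` satisfies the stability estimate
`sup_{x ∈ S} |r x| ≤ Λ · √(#I) · max_{x ∈ I} |g x|`. -/
theorem least_squares_reconstruction_stability
    {S : Type*} (P : Submodule ℝ (S → ℝ)) [FiniteDimensional ℝ P]
    (I : Finset S) (hI : I.Nonempty)
    (hA : ∀ p ∈ P, (∀ x ∈ I, p x = 0) → p = 0)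
    (Λ : ℝ) (hΛ : 0 ≤ Λ)
    (hbound : ∀ p ∈ P, ∀ x : S, |p x| ≤ Λ * I.sup' hI (fun y => |p y|))
    (g : S → ℝ)
    (r : S → ℝ) (hrP : r ∈ P)
    (hrmin : ∀ p ∈ P, ∑ x ∈ I, (g x - r x) ^ 2 ≤ ∑ x ∈ I, (g x - p x) ^ 2) :
    ∀ x : S, |r x| ≤ Λ * Real.sqrt I.card * I.sup' hI (fun y => |g y|) := by
  intro x
  refine (hbound r hrP x).trans ?_
  rw [mul_assoc]
  refine mul_le_mul_of_nonneg_left (Finset.sup'_le hI _ fun y hy => ?_) hΛ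
  set M := I.sup' hI fun y => |g y|
  have hM : ∀ z ∈ I, |g z| ≤ M := fun z hz => Finset.le_sup' (fun y => |g y|) hz
  have hM0 : 0 ≤ M := (abs_nonneg _).trans (hM y hy)
  refine abs_le_of_sq_le_sq ?_ (mul_nonneg (Real.sqrt_nonneg _) hM0)
  calc r y ^ 2 ≤ ∑ z ∈ I, r z ^ 2 :=
        Finset.single_le_sum (f := fun z => r z ^ 2) (fun z _ => sq_nonneg _) hy
    _ ≤ ∑ z ∈ I, g z ^ 2 := sum_sq_le_of_leastSquares hrP hrmin
    _ ≤ I.card • M ^ 2 := Finset.sum_le_card_nsmul _ _ _ fun z hz =>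
        sq_le_sq' (abs_le.mp (hM z hz)).1 (abs_le.mp (hM z hz)).2
    _ = (Real.sqrt I.card * M) ^ 2 := by
        rw [mul_pow, Real.sq_sqrt (Nat.cast_nonneg _), nsmul_eq_mul]
end

section
/- Suppose Assumption A holds and Λ ≥ 0 is a constant such that sup_{x ∈ S} |p(x)| ≤ Λ · max_{x ∈ I} |p(x)| for every p ∈ P. Then for every bounded function g : S → ℝ, the unique discrete least-squares reconstruction R g satisfies the quasi-optimal approximation property sup_{x ∈ S} |g(x) − (R g)(x)| ≤ (1 + Λ √(#I)) · inf_{p ∈ P} sup_{x ∈ S} |g(x) − p(x)|, where #I denotes the number of sampling points. -/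
/-- The residual of a least-squares minimizer over a subspace is orthogonal to that subspace. -/
theorem sum_residual_mul_eq_zero_of_isLeastSquares {S : Type*} {P : Submodule ℝ (S → ℝ)}
    {I : Finset S} {g r : S → ℝ} (hrP : r ∈ P)
    (hrmin : ∀ p ∈ P, ∑ x ∈ I, (g x - r x) ^ 2 ≤ ∑ x ∈ I, (g x - p x) ^ 2)
    {q : S → ℝ} (hq : q ∈ P) : ∑ x ∈ I, (g x - r x) * q x = 0 := by
  set A := ∑ x ∈ I, (g x - r x) * q x with hA
  set B := ∑ x ∈ I, q x ^ 2 with hB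
  have hB0 : 0 ≤ B := Finset.sum_nonneg fun x _ => sq_nonneg (q x)
  have hquad (t : ℝ) : 0 ≤ t ^ 2 * B - 2 * t * A := by
    have hexpand : ∑ x ∈ I, (g x - (r + t • q) x) ^ 2
        = ∑ x ∈ I, (g x - r x) ^ 2 + (t ^ 2 * B - 2 * t * A) := by
      rw [hA, hB, Finset.mul_sum, Finset.mul_sum, ← Finset.sum_sub_distrib,
        ← Finset.sum_add_distrib]
      refine Finset.sum_congr rfl fun x _ => ?_
      simp only [Pi.add_apply, Pi.smul_apply, smul_eq_mul]
      ring
    have hmin := hrmin (r + t • q) (P.add_mem hrP (P.smul_mem t hq))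
    linarith
  have h := hquad (A / (B + 1))
  have hB1 : 0 < B + 1 := by linarith
  have heq : (A / (B + 1)) ^ 2 * B - 2 * (A / (B + 1)) * A
      = -(A ^ 2 * (B + 2)) / (B + 1) ^ 2 := by
    field_simp
    ring
  rw [heq, le_div_iff₀ (by positivity)] at h
  have hA2 : A ^ 2 = 0 := by nlinarith [sq_nonneg A, mul_nonneg (sq_nonneg A) hB0]
  exact pow_eq_zero_iff two_ne_zero |>.mp hA2

/-- The discrete `ℓ²` distance from a least-squares minimizer `r` to any `p` in the subspace is at
most the discrete `ℓ²` distance from the data `g` to `p`. -/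
theorem sum_sq_sub_le_of_isLeastSquares {S : Type*} {P : Submodule ℝ (S → ℝ)}
    {I : Finset S} {g r : S → ℝ} (hrP : r ∈ P)
    (hrmin : ∀ p ∈ P, ∑ x ∈ I, (g x - r x) ^ 2 ≤ ∑ x ∈ I, (g x - p x) ^ 2)
    {p : S → ℝ} (hp : p ∈ P) :
    ∑ x ∈ I, (r x - p x) ^ 2 ≤ ∑ x ∈ I, (g x - p x) ^ 2 := by
  have horth : ∑ x ∈ I, (g x - r x) * (r x - p x) = 0 :=
    sum_residual_mul_eq_zero_of_isLeastSquares hrP hrmin (P.sub_mem hrP hp)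
  have hpyth : ∑ x ∈ I, (g x - p x) ^ 2 = ∑ x ∈ I, (g x - r x) ^ 2
      + 2 * ∑ x ∈ I, (g x - r x) * (r x - p x) + ∑ x ∈ I, (r x - p x) ^ 2 := by
    rw [Finset.mul_sum, ← Finset.sum_add_distrib, ← Finset.sum_add_distrib]
    exact Finset.sum_congr rfl fun x _ => by ring
  have hres : 0 ≤ ∑ x ∈ I, (g x - r x) ^ 2 := Finset.sum_nonneg fun x _ => sq_nonneg _
  linarith

/-- Under Assumption A, if `Λ ≥ 0` satisfies
`sup_{x ∈ S} |p x| ≤ Λ · max_{x ∈ I} |p x|` for all `p ∈ P`, then for every bounded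
`g : S → ℝ` the unique discrete least-squares reconstruction `r = R g` satisfies the
quasi-optimal approximation property
`sup_{x ∈ S} |g x - r x| ≤ (1 + Λ √(#I)) · inf_{p ∈ P} sup_{x ∈ S} |g x - p x|`,
expressed here as: for every `p ∈ P` and every bound `C` on `sup_x |g x - p x|`,
`|g x - r x| ≤ (1 + Λ √(#I)) · C` for all `x`. -/
theorem least_squares_reconstruction_quasi_optimal
    {S : Type*} (P : Submodule ℝ (S → ℝ)) [FiniteDimensional ℝ P]
    (I : Finset S) (hI : I.Nonempty)
    (hA : ∀ p ∈ P, (∀ x ∈ I, p x = 0) → p = 0)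
    (Λ : ℝ) (hΛ : 0 ≤ Λ)
    (hbound : ∀ p ∈ P, ∀ x : S, |p x| ≤ Λ * I.sup' hI (fun y => |p y|))
    (g : S → ℝ) (hgbdd : ∃ M : ℝ, ∀ x : S, |g x| ≤ M)
    (r : S → ℝ) (hrP : r ∈ P)
    (hrmin : ∀ p ∈ P, ∑ x ∈ I, (g x - r x) ^ 2 ≤ ∑ x ∈ I, (g x - p x) ^ 2) :
    ∀ p ∈ P, ∀ C : ℝ, (∀ x : S, |g x - p x| ≤ C) →
      ∀ x : S, |g x - r x| ≤ (1 + Λ * Real.sqrt I.card) * C := by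
  intro p hp C hC x
  have hC0 : 0 ≤ C := (abs_nonneg _).trans (hC x)
  have hsum : ∑ y ∈ I, (r y - p y) ^ 2 ≤ I.card * C ^ 2 := by
    refine (sum_sq_sub_le_of_isLeastSquares hrP hrmin hp).trans ?_
    rw [← nsmul_eq_mul]
    exact Finset.sum_le_card_nsmul _ _ _ fun y _ => sq_le_sq' (abs_le.mp (hC y)).1
      (abs_le.mp (hC y)).2
  have hsup : I.sup' hI (fun y => |(r - p) y|) ≤ Real.sqrt I.card * C := by
    refine Finset.sup'_le hI _ fun y hy => ?_
    refine abs_le_of_sq_le_sq (b := Real.sqrt I.card * C) ?_ (by positivity)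
    rw [mul_pow, Real.sq_sqrt (Nat.cast_nonneg _)]
    exact (Finset.single_le_sum (f := fun y => (r y - p y) ^ 2)
      (fun z _ => sq_nonneg _) hy).trans hsum
  have hdist : |r x - p x| ≤ Λ * (Real.sqrt I.card * C) :=
    (hbound (r - p) (P.sub_mem hrP hp) x).trans (mul_le_mul_of_nonneg_left hsup hΛ)
  calc |g x - r x| ≤ |g x - p x| + |p x - r x| := abs_sub_le _ _ _
    _ ≤ C + Λ * (Real.sqrt I.card * C) := add_le_add (hC x) (abs_sub_comm (p x) _ ▸ hdist)
    _ = (1 + Λ * Real.sqrt I.card) * C := by ring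
end

section
/- Let H be a complex Hilbert space and let T and S be bounded self-adjoint linear operators on H. Then for every μ in the spectrum of T there exists ν in the spectrum of S with |μ − ν| ≤ ‖T − S‖. In particular, if (T_n) is a sequence of bounded self-adjoint operators with ‖T − T_n‖ → 0, then every μ ∈ σ(T) is the limit of a sequence μ_n ∈ σ(T_n). -/
/-- The spectrum of a unit with normal inverse contains a point of norm `‖u⁻¹‖⁻¹`. -/
theorem Units.exists_mem_spectrum_norm_eq_inv_norm_inv
    {A : Type*} [CStarAlgebra A] [Nontrivial A] (u : Aˣ) [IsStarNormal (↑u⁻¹ : A)] :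
    ∃ z ∈ spectrum ℂ (u : A), ‖z‖ = ‖(↑u⁻¹ : A)‖⁻¹ := by
  obtain ⟨z, hz, hzn⟩ := spectrum.exists_nnnorm_eq_spectralRadius (↑u⁻¹ : A)
  rw [IsStarNormal.spectralRadius_eq_nnnorm, ENNReal.coe_inj] at hzn
  have hnorm : ‖z‖ = ‖(↑u⁻¹ : A)‖ := congrArg NNReal.toReal hzn
  have hz0 : z ≠ 0 := spectrum.ne_zero_of_mem_of_unit hz
  refine ⟨z⁻¹, ?_, by rw [norm_inv, hnorm]⟩
  simpa using (spectrum.inv_mem_iff (r := Units.mk0 z hz0)).mp hz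

/-- Spectral variation bound in a C⋆-algebra: each point of the spectrum of `b` lies within
`‖b - a‖` of the spectrum of a normal element `a`. -/
theorem IsStarNormal.exists_mem_spectrum_norm_sub_le
    {A : Type*} [CStarAlgebra A] {a b : A} (ha : IsStarNormal a)
    {μ : ℂ} (hμ : μ ∈ spectrum ℂ b) :
    ∃ ν ∈ spectrum ℂ a, ‖μ - ν‖ ≤ ‖b - a‖ := by
  by_cases hμa : μ ∈ spectrum ℂ a
  · exact ⟨μ, hμa, by simp⟩
  have : Nontrivial A := by
    by_contra h
    rw [not_nontrivial_iff_subsingleton] at h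
    exact hμ (isUnit_of_subsingleton _)
  obtain ⟨u, hu⟩ := spectrum.notMem_iff.mp hμa
  have hcomm : Commute (star (u : A)) (u : A) := by
    rw [hu, star_sub, ← algebraMap_star_comm]
    exact (Algebra.commute_algebraMap_left _ _).sub_left
      ((Algebra.commute_algebraMap_right _ _).sub_right ha.star_comm_self)
  have : IsStarNormal (↑u⁻¹ : A) := by
    refine ⟨?_⟩
    rw [← Units.coe_star_inv]
    exact Commute.units_inv_left (Commute.units_inv_right hcomm)
  obtain ⟨z, hz, hzn⟩ := u.exists_mem_spectrum_norm_eq_inv_norm_inv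
  refine ⟨μ - z, ?_, ?_⟩
  · rw [hu, ← spectrum.singleton_sub_eq] at hz
    obtain ⟨ν, hν, rfl⟩ := by simpa using hz
    simpa using hν
  · rw [sub_sub_cancel, hzn]
    by_contra! hlt
    refine hμ (u.ofNearby (algebraMap ℂ A μ - b) ?_).isUnit
    rwa [hu, sub_sub_sub_cancel_left, norm_sub_rev]

/-- Spectral perturbation of self-adjoint operators: every point of
`σ(T)` is within `‖T − S‖` of a point of `σ(S)`; in particular, if self-adjoint
`T_n → T` in operator norm, every `μ ∈ σ(T)` is the limit of `μ_n ∈ σ(T_n)`. -/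
theorem selfAdjoint_spectrum_perturbation
    {H : Type*} [NormedAddCommGroup H] [InnerProductSpace ℂ H] [CompleteSpace H]
    (T S : H →L[ℂ] H) (hT : IsSelfAdjoint T) (hS : IsSelfAdjoint S) :
    (∀ μ ∈ spectrum ℂ T, ∃ ν ∈ spectrum ℂ S, ‖μ - ν‖ ≤ ‖T - S‖) ∧
    (∀ Tn : ℕ → H →L[ℂ] H, (∀ n, IsSelfAdjoint (Tn n)) →
      Filter.Tendsto (fun n => ‖T - Tn n‖) Filter.atTop (nhds 0) →
      ∀ μ ∈ spectrum ℂ T, ∃ μn : ℕ → ℂ,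
        (∀ n, μn n ∈ spectrum ℂ (Tn n)) ∧
        Filter.Tendsto μn Filter.atTop (nhds μ)) := by
  refine ⟨fun μ hμ => hS.isStarNormal.exists_mem_spectrum_norm_sub_le hμ,
    fun Tn hTn hlim μ hμ => ?_⟩
  choose μn hmem hle using fun n =>
    (hTn n).isStarNormal.exists_mem_spectrum_norm_sub_le hμ
  refine ⟨μn, hmem, tendsto_iff_norm_sub_tendsto_zero.mpr ?_⟩
  exact squeeze_zero (fun n => norm_nonneg _)
    (fun n => (norm_sub_rev _ _).trans_le (hle n)) hlim
end

section
/- Let W be a real inner product space and a : W × W → ℝ a symmetric bilinear form. Suppose (λ, u) is an eigenpair of a with respect to the inner product, i.e. a(u, v) = λ ⟨u, v⟩ for all v ∈ W. Then for every w ∈ W with ⟨w, w⟩ ≠ 0, the Rayleigh quotient satisfies the identity a(w, w)/⟨w, w⟩ − λ = ( a(w − u, w − u) − λ ‖w − u‖² ) / ‖w‖². -/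
open RealInnerProductSpace

/-- Rayleigh-quotient error identity. If `a` is a symmetric bilinear
form on a real inner product space `W` and `(λ, u)` is an eigenpair, i.e.
`a u v = λ ⟪u, v⟫` for all `v`, then for every `w` with `⟪w, w⟫ ≠ 0`,
`a(w,w)/⟪w,w⟫ − λ = (a(w−u, w−u) − λ ‖w−u‖²) / ‖w‖²`. -/
theorem rayleigh_quotient_error_identity
    {W : Type*} [NormedAddCommGroup W] [InnerProductSpace ℝ W]
    (a : W →ₗ[ℝ] W →ₗ[ℝ] ℝ)
    (hsymm : ∀ v w : W, a v w = a w v)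
    (lam : ℝ) (u : W)
    (heig : ∀ v : W, a u v = lam * ⟪u, v⟫)
    (w : W) (hw : ⟪w, w⟫ ≠ 0) :
    a w w / ⟪w, w⟫ - lam = (a (w - u) (w - u) - lam * ‖w - u‖ ^ 2) / ‖w‖ ^ 2 := by
  have hnum : a (w - u) (w - u) - lam * ⟪w - u, w - u⟫ = a w w - lam * ⟪w, w⟫ := by
    simp only [map_sub, LinearMap.sub_apply, inner_sub_left, inner_sub_right, hsymm w u, heig,
      real_inner_comm u w]
    ring
  rw [← real_inner_self_eq_norm_sq, ← real_inner_self_eq_norm_sq, hnum]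
  field_simp
end
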